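/- arXiv:math/0204112 — 6 statements merged into one kernel-verified Lean document; each statement's English description precedes it below -/
import Mathlib

section
/- Let A be an involutive quantale which is a right Hilbert A-module over itself (with action given by multiplication and inner product ⟨a,b⟩ = a*·b). Then for every right Hilbert A-module M, A is right separating for M: if m⋄a = n⋄a for all a ∈ A, then m = n. -/
universe u v w

set_option autoImplicit false

/-- An involutive quantale: a complete lattice with an associative multiplication
distributing over arbitrary joins in both arguments, together with an involution. -/
class InvQuantale (A : Type u) extends CompleteLattice A, Mul A, Star A where
  qmul_assoc : ∀ a b c : A, a * b * c = a * (b * c)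
  mul_sSup : ∀ (a : A) (S : Set A), a * sSup S = ⨆ b ∈ S, a * b
  sSup_mul : ∀ (S : Set A) (a : A), sSup S * a = ⨆ b ∈ S, b * a
  qstar_star : ∀ a : A, star (star a) = a
  star_sSup : ∀ S : Set A, star (sSup S) = ⨆ a ∈ S, star a
  qstar_mul : ∀ a b : A, star (a * b) = star b * star a

namespace Quantale

variable {A : Type u} [InvQuantale A]

theorem mul_iSup {ι : Sort w} (a : A) (f : ι → A) :
    (a * ⨆ i, f i) = ⨆ i, a * f i := by
  rw [iSup, InvQuantale.mul_sSup, iSup_range]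

theorem iSup_mul {ι : Sort w} (f : ι → A) (a : A) :
    (⨆ i, f i) * a = ⨆ i, f i * a := by
  rw [iSup, InvQuantale.sSup_mul, iSup_range]

theorem star_iSup {ι : Sort w} (f : ι → A) :
    star (⨆ i, f i) = ⨆ i, star (f i) := by
  rw [iSup, InvQuantale.star_sSup, iSup_range]

end Quantale

/-- A quantale is unital if it has a two-sided unit for the multiplication. -/
def InvQuantale.IsUnital (A : Type u) [InvQuantale A] : Prop :=
  ∃ e : A, ∀ a : A, e * a = a ∧ a * e = a
section Modules

/-- A right module over an involutive quantale. -/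
class QMod (A : Type u) [InvQuantale A] (M : Type v) [CompleteLattice M] where
  act : M → A → M
  act_mul : ∀ (m : M) (a b : A), act m (a * b) = act (act m a) b
  sSup_act : ∀ (S : Set M) (a : A), act (sSup S) a = ⨆ m ∈ S, act m a
  act_sSup : ∀ (m : M) (S : Set A), act m (sSup S) = ⨆ a ∈ S, act m a

/-- The module action `m ⋄ a`. -/
abbrev qact {A : Type u} [InvQuantale A] {M : Type v} [CompleteLattice M] [QMod A M]
    (m : M) (a : A) : M := QMod.act m a

/-- A right pre-Hilbert module over an involutive quantale. -/
class QPreHilb (A : Type u) [InvQuantale A] (M : Type v) [CompleteLattice M] extends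
    QMod A M where
  ip : M → M → A
  ip_mul : ∀ (m n : M) (a : A), ip m n * a = ip m (act n a)
  sSup_ip : ∀ (S : Set M) (n : M), ip (sSup S) n = ⨆ m ∈ S, ip m n
  ip_sSup : ∀ (m : M) (S : Set M), ip m (sSup S) = ⨆ n ∈ S, ip m n
  star_ip : ∀ m n : M, star (ip m n) = ip n m

/-- The inner product `⟨m, n⟩` with values in `A`. -/
abbrev qip (A : Type u) [InvQuantale A] {M : Type v} [CompleteLattice M] [QPreHilb A M]
    (m n : M) : A := QPreHilb.ip m n

/-- A right Hilbert module: a pre-Hilbert module whose inner product separates points. -/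
class QHilb (A : Type u) [InvQuantale A] (M : Type v) [CompleteLattice M] extends
    QPreHilb A M where
  ip_sep : ∀ m n : M, (∀ p : M, ip p m = ip p n) → m = n

variable {A : Type u} [InvQuantale A]

theorem qact_iSup_left {M : Type v} [CompleteLattice M] [QMod A M] {ι : Sort w}
    (f : ι → M) (a : A) : qact (⨆ i, f i) a = ⨆ i, qact (f i) a := by
  rw [iSup]; exact (QMod.sSup_act _ _).trans iSup_range

theorem qact_iSup_right {M : Type v} [CompleteLattice M] [QMod A M] {ι : Sort w}
    (m : M) (f : ι → A) : qact m (⨆ i, f i) = ⨆ i, qact m (f i) := by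
  rw [iSup]; exact (QMod.act_sSup _ _).trans iSup_range

theorem qip_iSup_left {M : Type v} [CompleteLattice M] [QPreHilb A M] {ι : Sort w}
    (f : ι → M) (n : M) : qip A (⨆ i, f i) n = ⨆ i, qip A (f i) n := by
  rw [iSup]; exact (QPreHilb.sSup_ip _ _).trans iSup_range

theorem qip_iSup_right {M : Type v} [CompleteLattice M] [QPreHilb A M] {ι : Sort w}
    (m : M) (f : ι → M) : qip A m (⨆ i, f i) = ⨆ i, qip A m (f i) := by
  rw [iSup]; exact (QPreHilb.ip_sSup _ _).trans iSup_range

/-- A module is essential if every element is a join of elements of the form `m ⋄ a`. -/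
def Essential (A : Type u) [InvQuantale A] (M : Type v) [CompleteLattice M] [QMod A M] :
    Prop :=
  ∀ m : M, m = sSup {x : M | (∃ (p : M) (a : A), x = qact p a) ∧ x ≤ m}

/-- A module is separated by `A` if the right actions separate points. -/
def Separated (A : Type u) [InvQuantale A] (M : Type v) [CompleteLattice M] [QMod A M] :
    Prop :=
  ∀ m n : M, (∀ a : A, qact m a = qact n a) → m = n

/-- A module is m-regular if it is essential and separated. -/
def MRegMod (A : Type u) [InvQuantale A] (M : Type v) [CompleteLattice M] [QMod A M] :
    Prop :=
  Essential A M ∧ Separated A M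

/-- A pre-Hilbert module is full if every element of `A` is a join of inner products. -/
def FullMod (A : Type u) [InvQuantale A] (M : Type v) [CompleteLattice M] [QPreHilb A M] :
    Prop :=
  ∀ a : A, a = sSup {b : A | (∃ m n : M, b = qip A m n) ∧ b ≤ a}

/-- An involutive quantale with multiplication as right action on itself. -/
instance selfQMod : QMod A A where
  act m a := m * a
  act_mul m a b := (InvQuantale.qmul_assoc m a b).symm
  sSup_act S a := InvQuantale.sSup_mul S a
  act_sSup m S := InvQuantale.mul_sSup m S

/-- An involutive quantale as a pre-Hilbert module over itself, with `⟨a, b⟩ = a⋆ · b`. -/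
instance selfQPreHilb : QPreHilb A A where
  ip a b := star a * b
  ip_mul m n a := InvQuantale.qmul_assoc _ _ _
  sSup_ip S n := by
    show star (sSup S) * n = ⨆ m ∈ S, star m * n
    rw [InvQuantale.star_sSup]
    simp only [Quantale.iSup_mul]
  ip_sSup m S := InvQuantale.mul_sSup _ S
  star_ip m n := by
    rw [InvQuantale.qstar_mul, InvQuantale.qstar_star]

/-- An involutive quantale is m-regular if it is m-regular as a right module over itself. -/
def InvQuantale.MReg (A : Type u) [InvQuantale A] : Prop := MRegMod A A

/-- If right multiplications separate the points of `A`, then `A` is a right Hilbert module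
over itself. -/
def selfQHilb (hsep : ∀ a b : A, (∀ c : A, a * c = b * c) → a = b) : QHilb A A where
  toQPreHilb := selfQPreHilb
  ip_sep := by
    intro m n h
    have h2 : ∀ c : A, star m * c = star n * c := by
      intro c
      have h1 : star c * m = star c * n := h c
      have h3 := congrArg star h1
      rw [InvQuantale.qstar_mul, InvQuantale.qstar_mul, InvQuantale.qstar_star] at h3
      exact h3
    have h4 := hsep _ _ h2
    have h5 := congrArg star h4
    rwa [InvQuantale.qstar_star, InvQuantale.qstar_star] at h5

end Modules
section Pi

variable {A : Type u} [InvQuantale A]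

/-- Pointwise right module structure on a power of a module. -/
instance piQMod (J : Type w) (M : Type v) [CompleteLattice M] [QMod A M] :
    QMod A (J → M) where
  act v a := fun j => qact (v j) a
  act_mul v a b := funext fun j => QMod.act_mul (v j) a b
  sSup_act S a := by
    funext j
    show qact (sSup S j) a = _
    rw [sSup_apply, qact_iSup_left, iSup_subtype]
    simp only [iSup_apply]
  act_sSup v S := by
    funext j
    show qact (v j) (sSup S) = _
    rw [show qact (v j) (sSup S) = ⨆ a ∈ S, qact (v j) a from QMod.act_sSup _ _]
    simp only [iSup_apply]

/-- Pointwise pre-Hilbert structure on a power of a pre-Hilbert module, with inner product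
`⟨v, w⟩ = ⨆ j, ⟨v j, w j⟩`.  In particular `A^J` carries the inner product
`⟨(a_j), (b_j)⟩ = ⨆ j, a_j⋆ · b_j`. -/
instance piQPreHilb (J : Type w) (M : Type v) [CompleteLattice M] [QPreHilb A M] :
    QPreHilb A (J → M) where
  ip v w := ⨆ j, qip A (v j) (w j)
  ip_mul v w a := by
    show (⨆ j, qip A (v j) (w j)) * a = ⨆ j, qip A (v j) (qact (w j) a)
    rw [Quantale.iSup_mul]
    exact iSup_congr fun j => QPreHilb.ip_mul _ _ _
  sSup_ip S w := by
    show (⨆ j, qip A (sSup S j) (w j)) = ⨆ v ∈ S, ⨆ j, qip A (v j) (w j)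
    calc (⨆ j, qip A (sSup S j) (w j))
        = ⨆ j, ⨆ f : S, qip A ((f : J → M) j) (w j) := by
          refine iSup_congr fun j => ?_
          rw [sSup_apply, qip_iSup_left]
      _ = ⨆ f : S, ⨆ j, qip A ((f : J → M) j) (w j) := iSup_comm
      _ = ⨆ v ∈ S, ⨆ j, qip A (v j) (w j) := by rw [iSup_subtype]
  ip_sSup v S := by
    show (⨆ j, qip A (v j) (sSup S j)) = ⨆ w ∈ S, ⨆ j, qip A (v j) (w j)
    calc (⨆ j, qip A (v j) (sSup S j))
        = ⨆ j, ⨆ f : S, qip A (v j) ((f : J → M) j) := by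
          refine iSup_congr fun j => ?_
          rw [sSup_apply, qip_iSup_right]
      _ = ⨆ f : S, ⨆ j, qip A (v j) ((f : J → M) j) := iSup_comm
      _ = ⨆ w ∈ S, ⨆ j, qip A (v j) (w j) := by rw [iSup_subtype]
  star_ip v w := by
    show star (⨆ j, qip A (v j) (w j)) = ⨆ j, qip A (w j) (v j)
    rw [Quantale.star_iSup]
    exact iSup_congr fun j => QPreHilb.star_ip _ _

end Pi

section Maps

variable {A : Type u} [InvQuantale A]

/-- A module homomorphism: a join-preserving map commuting with the action. -/
def IsModHom (A : Type u) [InvQuantale A] {M : Type v} {N : Type w}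
    [CompleteLattice M] [CompleteLattice N] [QMod A M] [QMod A N] (f : M → N) : Prop :=
  (∀ S : Set M, f (sSup S) = ⨆ m ∈ S, f m) ∧ ∀ (m : M) (a : A), f (qact m a) = qact (f m) a

/-- `g` is a ⋆-adjoint of `f`: `⟨f m, n⟩ = ⟨m, g n⟩`. -/
def IsAdjointPair (A : Type u) [InvQuantale A] {M : Type v} {N : Type w}
    [CompleteLattice M] [CompleteLattice N] [QPreHilb A M] [QPreHilb A N]
    (f : M → N) (g : N → M) : Prop :=
  ∀ (m : M) (n : N), qip A (f m) n = qip A m (g n)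

/-- A map between (pre-)Hilbert modules is adjointable if it has a ⋆-adjoint. -/
def Adjointable (A : Type u) [InvQuantale A] {M : Type v} {N : Type w}
    [CompleteLattice M] [CompleteLattice N] [QPreHilb A M] [QPreHilb A N]
    (f : M → N) : Prop :=
  ∃ g : N → M, IsAdjointPair A f g

theorem IsAdjointPair.symm' {M : Type v} {N : Type w}
    [CompleteLattice M] [CompleteLattice N] [QPreHilb A M] [QPreHilb A N]
    {f : M → N} {g : N → M} (h : IsAdjointPair A f g) : IsAdjointPair A g f := by
  intro n m
  calc qip A (g n) m = star (qip A m (g n)) := (QPreHilb.star_ip m (g n)).symm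
    _ = star (qip A (f m) n) := by rw [h m n]
    _ = qip A n (f m) := QPreHilb.star_ip _ _

/-- The rank-one operator `Θ_{n,m} : x ↦ n ⋄ ⟨m, x⟩`. -/
def theta (A : Type u) [InvQuantale A] {M : Type v} {N : Type w}
    [CompleteLattice M] [CompleteLattice N] [QPreHilb A M] [QPreHilb A N]
    (n : N) (m : M) : M → N :=
  fun x => qact n (qip A m x)

/-- A compact operator: an arbitrary (pointwise) join of rank-one operators `Θ_{n,m}`. -/
def IsCompactOp (A : Type u) [InvQuantale A] {M : Type v} {N : Type w}
    [CompleteLattice M] [CompleteLattice N] [QPreHilb A M] [QPreHilb A N]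
    (f : M → N) : Prop :=
  ∃ S : Set (N × M), ∀ x : M, f x = ⨆ p ∈ S, theta A p.1 p.2 x

end Maps

section LeftModules

/-- A left module over an involutive quantale. -/
class QLMod (A : Type u) [InvQuantale A] (M : Type v) [CompleteLattice M] where
  lact : A → M → M
  lact_mul : ∀ (a b : A) (m : M), lact (a * b) m = lact a (lact b m)
  sSup_lact : ∀ (S : Set A) (m : M), lact (sSup S) m = ⨆ a ∈ S, lact a m
  lact_sSup : ∀ (a : A) (S : Set M), lact a (sSup S) = ⨆ m ∈ S, lact a m

/-- A left pre-Hilbert module over an involutive quantale. -/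
class QLPreHilb (A : Type u) [InvQuantale A] (M : Type v) [CompleteLattice M] extends
    QLMod A M where
  lip : M → M → A
  lip_lact : ∀ (a : A) (m n : M), a * lip m n = lip (lact a m) n
  sSup_lip : ∀ (S : Set M) (n : M), lip (sSup S) n = ⨆ m ∈ S, lip m n
  lip_sSup : ∀ (m : M) (S : Set M), lip m (sSup S) = ⨆ n ∈ S, lip m n
  star_lip : ∀ m n : M, star (lip m n) = lip n m

/-- A left Hilbert module. -/
class QLHilb (A : Type u) [InvQuantale A] (M : Type v) [CompleteLattice M] extends
    QLPreHilb A M where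
  lip_sep : ∀ m n : M, (∀ p : M, lip m p = lip n p) → m = n

/-- A left module is essential if every element is a join of elements `a • m`. -/
def LEssential (A : Type u) [InvQuantale A] (M : Type v) [CompleteLattice M] [QLMod A M] :
    Prop :=
  ∀ m : M, m = sSup {x : M | (∃ (a : A) (p : M), x = QLMod.lact a p) ∧ x ≤ m}

/-- A left module is separated by `A` if the left actions separate points. -/
def LSeparated (A : Type u) [InvQuantale A] (M : Type v) [CompleteLattice M] [QLMod A M] :
    Prop :=
  ∀ m n : M, (∀ a : A, QLMod.lact a m = QLMod.lact a n) → m = n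

/-- A left pre-Hilbert module is full if every element of `A` is a join of inner products. -/
def LFull (A : Type u) [InvQuantale A] (M : Type v) [CompleteLattice M] [QLPreHilb A M] :
    Prop :=
  ∀ a : A, a = sSup {b : A | (∃ m n : M, b = QLPreHilb.lip m n) ∧ b ≤ a}

end LeftModules
open CategoryTheory

section Categories

variable {A : Type u} [InvQuantale A]

/-- An object of the category `mreg-Hilb_A` (or `mreg-HMOD_A`): an m-regular right
Hilbert `A`-module. -/
structure HObj (A : Type u) [InvQuantale A] : Type (u + 1) where
  carrier : Type u
  [lat : CompleteLattice carrier]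
  [str : QHilb A carrier]
  ess : Essential A carrier
  sep : Separated A carrier

attribute [instance] HObj.lat HObj.str

instance : CoeSort (HObj A) (Type u) := ⟨HObj.carrier⟩

/-- The category `mreg-Hilb_A` of m-regular right Hilbert `A`-modules with
adjointable maps as morphisms. -/
instance HObj.cat : Category.{u} (HObj A) where
  Hom M N := {f : M.carrier → N.carrier // Adjointable A f}
  id M := ⟨fun m => m, ⟨fun m => m, fun _ _ => rfl⟩⟩
  comp {M N P} f g := ⟨fun m => g.1 (f.1 m), by
    obtain ⟨f', hf⟩ := f.2
    obtain ⟨g', hg⟩ := g.2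
    exact ⟨fun p => f' (g' p), fun m p => (hg (f.1 m) p).trans (hf m (g' p))⟩⟩
  id_comp f := Subtype.ext rfl
  comp_id f := Subtype.ext rfl
  assoc f g h := Subtype.ext rfl

/-- Construct a morphism of `mreg-Hilb_A`. -/
def mkHom {M N : HObj A} (f : M.carrier → N.carrier) (hf : Adjointable A f) : M ⟶ N :=
  ⟨f, hf⟩

/-- The underlying function of a morphism. -/
def homFn {M N : HObj A} (f : M ⟶ N) : M.carrier → N.carrier := f.1

/-- The ⋆-adjoint of a morphism of `mreg-Hilb_A`. -/
noncomputable def hStar {M N : HObj A} (f : M ⟶ N) : N ⟶ M :=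
  ⟨Classical.choose f.2, ⟨f.1, (Classical.choose_spec f.2).symm'⟩⟩

theorem hStar_adj {M N : HObj A} (f : M ⟶ N) : IsAdjointPair A f.1 (hStar f).1 :=
  Classical.choose_spec f.2

/-- The join of a set of morphisms of `mreg-Hilb_A`, computed pointwise. -/
noncomputable def hSup {M N : HObj A} (S : Set (M ⟶ N)) : M ⟶ N :=
  ⟨fun m => ⨆ f ∈ S, (f : M ⟶ N).1 m,
   ⟨fun n => ⨆ f ∈ S, (hStar f).1 n, by
      intro m n
      have L : qip A (⨆ f ∈ S, (f : M ⟶ N).1 m) n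
          = ⨆ f ∈ S, qip A ((f : M ⟶ N).1 m) n := by
        rw [qip_iSup_left]
        exact iSup_congr fun f => qip_iSup_left _ _
      have R : qip A m (⨆ f ∈ S, (hStar f).1 n)
          = ⨆ f ∈ S, qip A m ((hStar f).1 n) := by
        rw [qip_iSup_right]
        exact iSup_congr fun f => qip_iSup_right _ _
      rw [L, R]
      exact iSup_congr fun f => iSup_congr fun _ => hStar_adj f m n⟩⟩

/-- A morphism is unitary if its ⋆-adjoint is a two-sided inverse. -/
noncomputable def IsUnitaryHom {M N : HObj A} (f : M ⟶ N) : Prop :=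
  f ≫ hStar f = 𝟙 M ∧ hStar f ≫ f = 𝟙 N

end Categories

section Functors

/-- A (join-preserving) ⋆-functor between the categories `mreg-Hilb_A` and `mreg-Hilb_B`. -/
structure StarFunctor (A B : Type u) [InvQuantale A] [InvQuantale B] : Type (u + 1) where
  toFunctor : HObj A ⥤ HObj B
  map_star : ∀ {M N : HObj A} (f : M ⟶ N),
    toFunctor.map (hStar f) = hStar (toFunctor.map f)
  map_hSup : ∀ {M N : HObj A} (S : Set (M ⟶ N)),
    toFunctor.map (hSup S) = hSup (toFunctor.map '' S)

/-- Morita equivalence of involutive quantales: there are ⋆-functors `F, G` between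
`mreg-Hilb_A` and `mreg-Hilb_B` with `GF ≅ Id` and `FG ≅ Id` via unitary natural
isomorphisms. -/
def Morita (A B : Type u) [InvQuantale A] [InvQuantale B] : Prop :=
  ∃ (F : StarFunctor A B) (G : StarFunctor B A)
    (η : F.toFunctor ⋙ G.toFunctor ⟶ 𝟭 (HObj A))
    (ζ : G.toFunctor ⋙ F.toFunctor ⟶ 𝟭 (HObj B)),
    (∀ M : HObj A, IsUnitaryHom (η.app M)) ∧ (∀ N : HObj B, IsUnitaryHom (ζ.app N))

variable {A : Type u} [InvQuantale A]

/-- An m-regular involutive quantale as an object of `mreg-Hilb_A`. -/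
def selfObj (A : Type u) [InvQuantale A] (hA : InvQuantale.MReg A) : HObj A where
  carrier := A
  lat := inferInstance
  str := selfQHilb hA.2
  ess := hA.1
  sep := hA.2

/-- Left multiplication by `a` as a morphism `A ⟶ A` of `mreg-Hilb_A`. -/
def lmulHom (A : Type u) [InvQuantale A] (hA : InvQuantale.MReg A) (a : A) :
    selfObj A hA ⟶ selfObj A hA :=
  ⟨fun (b : A) => a * b, ⟨fun (b : A) => Star.star a * b, fun (m n : A) => by
    show Star.star (a * m) * n = Star.star m * (Star.star a * n)
    rw [InvQuantale.qstar_mul, InvQuantale.qmul_assoc]⟩⟩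

/-- The left `A`-action `a • z = F(L_a)(z)` on `Z = F(A)` used in the Eilenberg-Watts
theorem. -/
def EWact {A B : Type u} [InvQuantale A] [InvQuantale B] (hA : InvQuantale.MReg A)
    (F : StarFunctor A B) :
    A → (F.toFunctor.obj (selfObj A hA)).carrier → (F.toFunctor.obj (selfObj A hA)).carrier :=
  fun a z => (F.toFunctor.map (lmulHom A hA a)).1 z

end Functors
section Bimodules

/-- A right Hilbert `A`–`B` bimodule structure: `M` is a right Hilbert `B`-module with a
compatible left `A`-action. -/
structure IsRightHilbBimod (A B : Type u) [InvQuantale A] [InvQuantale B]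
    (M : Type u) [CompleteLattice M] [QHilb B M] (lact : A → M → M) : Prop where
  lact_mul : ∀ (a b : A) (m : M), lact (a * b) m = lact a (lact b m)
  sSup_lact : ∀ (S : Set A) (m : M), lact (sSup S) m = ⨆ a ∈ S, lact a m
  lact_sSup : ∀ (a : A) (S : Set M), lact a (sSup S) = ⨆ m ∈ S, lact a m
  lact_act : ∀ (a : A) (x : M) (b : B), lact a (qact x b) = qact (lact a x) b
  ip_lact : ∀ (a : A) (x y : M), qip B (lact a x) y = qip B x (lact (Star.star a) y)

/-- A left action is essential if every element is a join of elements `a • m`. -/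
def LEssentialAct {A : Type u} {M : Type u} [CompleteLattice M] (lact : A → M → M) : Prop :=
  ∀ m : M, m = sSup {x : M | (∃ (a : A) (p : M), x = lact a p) ∧ x ≤ m}

/-- `t : M × N → P` realizes `P` as the interior tensor product `M ⊗̇_A N` of the right
Hilbert `A`-module `M` with the right Hilbert `A`–`B` bimodule `N` (with left action
`lactN`): `t` is bilinear for joins, its image join-generates `P`, and
`⟨x₁ ⊗ y₁, x₂ ⊗ y₂⟩ = ⟨y₁, ⟨x₁,x₂⟩ • y₂⟩`. -/
structure IsInteriorTensor (A B : Type u) [InvQuantale A] [InvQuantale B]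
    {M : Type u} [CompleteLattice M] [QHilb A M]
    {N : Type u} [CompleteLattice N] [QHilb B N] (lactN : A → N → N)
    {P : Type u} [CompleteLattice P] [QHilb B P]
    (t : M → N → P) : Prop where
  ip_t : ∀ (x₁ x₂ : M) (y₁ y₂ : N),
    qip B (t x₁ y₁) (t x₂ y₂) = qip B y₁ (lactN (qip A x₁ x₂) y₂)
  sSup_t : ∀ (S : Set M) (y : N), t (sSup S) y = ⨆ x ∈ S, t x y
  t_sSup : ∀ (x : M) (S : Set N), t x (sSup S) = ⨆ y ∈ S, t x y
  gen : ∀ p : P, p = sSup {q : P | (∃ x y, q = t x y) ∧ q ≤ p}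

/-- A bundled right Hilbert `A`-module. -/
structure HilbMod (A : Type u) [InvQuantale A] : Type (u + 1) where
  carrier : Type u
  [lat : CompleteLattice carrier]
  [str : QHilb A carrier]

attribute [instance] HilbMod.lat HilbMod.str

/-- A bundled right Hilbert `A`–`B` bimodule. -/
structure BimodObj (A B : Type u) [InvQuantale A] [InvQuantale B] : Type (u + 1) where
  carrier : Type u
  [lat : CompleteLattice carrier]
  [str : QHilb B carrier]
  lact : A → carrier → carrier
  bimod : IsRightHilbBimod A B carrier lact

attribute [instance] BimodObj.lat BimodObj.str

/-- An imprimitivity `A`–`B` bimodule structure on `X`: a full m-regular right Hilbert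
`B`-module and full m-regular left Hilbert `A`-module with compatible structures. -/
structure IsImprim (A B : Type u) [InvQuantale A] [InvQuantale B]
    (X : Type u) [CompleteLattice X] [QHilb B X]
    (lact : A → X → X) (lip : X → X → A) : Prop where
  bimod : IsRightHilbBimod A B X lact
  lip_lact : ∀ (a : A) (x y : X), a * lip x y = lip (lact a x) y
  sSup_lip : ∀ (S : Set X) (y : X), lip (sSup S) y = ⨆ x ∈ S, lip x y
  lip_sSup : ∀ (x : X) (S : Set X), lip x (sSup S) = ⨆ y ∈ S, lip x y
  star_lip : ∀ x y : X, Star.star (lip x y) = lip y x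
  lip_sep : ∀ x y : X, (∀ z : X, lip x z = lip y z) → x = y
  rfull : ∀ b : B, b = sSup {c : B | (∃ x y : X, c = qip B x y) ∧ c ≤ b}
  lfull : ∀ a : A, a = sSup {c : A | (∃ x y : X, c = lip x y) ∧ c ≤ a}
  ress : Essential B X
  rsep : Separated B X
  less : LEssentialAct lact
  lsep : ∀ m n : X, (∀ a : A, lact a m = lact a n) → m = n
  imp1 : ∀ x y z : X, lact (lip x y) z = qact x (qip B y z)
  imp2 : ∀ (x y : X) (b : B), lip (qact x b) y = lip x (qact y (Star.star b))

/-- A bundled imprimitivity `A`–`B` bimodule; `A` and `B` are strongly Morita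
equivalent iff such a bimodule exists. -/
structure ImprimObj (A B : Type u) [InvQuantale A] [InvQuantale B] : Type (u + 1) where
  carrier : Type u
  [lat : CompleteLattice carrier]
  [str : QHilb B carrier]
  lact : A → carrier → carrier
  lip : carrier → carrier → A
  imprim : IsImprim A B carrier lact lip

attribute [instance] ImprimObj.lat ImprimObj.str

end Bimodules

section Constructions

/-- The opposite involutive quantale `A^d`, with multiplication `a ∘ b = b · a`. -/
def InvQuantale.dual (A : Type u) [iq : InvQuantale A] : InvQuantale A :=
  { iq.toCompleteLattice with
    mul := fun a b => b * a
    star := fun a => Star.star a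
    qmul_assoc := fun a b c => (InvQuantale.qmul_assoc c b a).symm
    mul_sSup := fun a S => InvQuantale.sSup_mul S a
    sSup_mul := fun S a => InvQuantale.mul_sSup a S
    qstar_star := fun a => InvQuantale.qstar_star a
    star_sSup := fun S => InvQuantale.star_sSup S
    qstar_mul := fun a b => InvQuantale.qstar_mul b a }

/-- The involutive quantale of `J × J` matrices over `A`, with matrix multiplication
(joins in place of sums) and conjugate-transpose involution. -/
def MatrixQuantale (A : Type u) [InvQuantale A] (J : Type u) :
    InvQuantale (J → J → A) :=
  { (inferInstance : CompleteLattice (J → J → A)) with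
    mul := fun X Y i k => ⨆ j, X i j * Y j k
    star := fun X i j => Star.star (X j i)
    qmul_assoc := by
      intro X Y Z
      funext i l
      show (⨆ k, (⨆ j, X i j * Y j k) * Z k l) = ⨆ j, X i j * ⨆ k, Y j k * Z k l
      calc (⨆ k, (⨆ j, X i j * Y j k) * Z k l)
          = ⨆ k, ⨆ j, (X i j * Y j k) * Z k l := by
            exact iSup_congr fun k => Quantale.iSup_mul _ _
        _ = ⨆ j, ⨆ k, X i j * (Y j k * Z k l) := by
            rw [iSup_comm]
            exact iSup_congr fun j => iSup_congr fun k => InvQuantale.qmul_assoc _ _ _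
        _ = ⨆ j, X i j * ⨆ k, Y j k * Z k l := by
            exact iSup_congr fun j => (Quantale.mul_iSup _ _).symm
    mul_sSup := by
      intro X S
      funext i k
      show (⨆ j, X i j * sSup S j k) = _
      simp only [sSup_apply, iSup_apply, Quantale.mul_iSup]
      rw [iSup_comm]
      rw [iSup_subtype]
      rfl
    sSup_mul := by
      intro S X
      funext i k
      show (⨆ j, sSup S i j * X j k) = _
      simp only [sSup_apply, iSup_apply, Quantale.iSup_mul]
      rw [iSup_comm]
      rw [iSup_subtype]
      rfl
    qstar_star := by
      intro X
      funext i j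
      exact InvQuantale.qstar_star _
    star_sSup := by
      intro S
      funext i j
      show Star.star (sSup S j i) = _
      simp only [sSup_apply, iSup_apply, Quantale.star_iSup]
      rw [iSup_subtype]
    qstar_mul := by
      intro X Y
      funext i l
      show Star.star (⨆ j, X l j * Y j i) = ⨆ j, Star.star (Y j i) * Star.star (X l j)
      rw [Quantale.star_iSup]
      exact iSup_congr fun j => InvQuantale.qstar_mul _ _ }

/-- The property of belonging to the centre of `A`: a join-preserving bimodule
endomorphism that is adjointable for the right and left inner products. -/
def IsCen (A : Type u) [InvQuantale A] (f : A → A) : Prop :=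
  (∀ S : Set A, f (sSup S) = ⨆ a ∈ S, f a) ∧
  (∀ a b : A, f (a * b) = f a * b) ∧
  (∀ a b : A, f (a * b) = a * f b) ∧
  Adjointable A f ∧
  (∃ g : A → A, ∀ a b : A, f a * Star.star b = a * Star.star (g b))

/-- The centre of an m-regular involutive quantale. -/
def Cen (A : Type u) [InvQuantale A] : Type u := {f : A → A // IsCen A f}

end Constructions
/-- Let `A` be an involutive quantale which is a right Hilbert
`A`-module over itself (action = multiplication, `⟨a,b⟩ = a⋆·b`; only the
separation axiom is an extra hypothesis `hA`).  Then for every right Hilbert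
`A`-module `M`, `A` is right separating for `M`. -/
theorem quantale_right_separating (A : Type u) [InvQuantale A]
    (hA : ∀ a b : A, (∀ p : A, Star.star p * a = Star.star p * b) → a = b)
    (M : Type v) [CompleteLattice M] [QHilb A M] :
    ∀ m n : M, (∀ a : A, qact m a = qact n a) → m = n := by
  intro m n h
  apply QHilb.ip_sep (A := A)
  intro p
  have key : (QPreHilb.ip m p : A) = QPreHilb.ip n p := by
    apply hA
    intro a
    have h1 : (QPreHilb.ip p m : A) * a = QPreHilb.ip p n * a := by
      rw [QPreHilb.ip_mul, QPreHilb.ip_mul]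
      exact congrArg (fun x => (QPreHilb.ip p x : A)) (h a)
    have h2 := congrArg Star.star h1
    rwa [InvQuantale.qstar_mul, InvQuantale.qstar_mul, QPreHilb.star_ip,
      QPreHilb.star_ip] at h2
  have h3 := congrArg Star.star key
  rwa [QPreHilb.star_ip, QPreHilb.star_ip] at h3
end

section
/- Let A be an m-regular involutive quantale and let M be a full m-regular right Hilbert A-module. Then the compact operators K_A(M) form an m-regular involutive quantale (with composition as multiplication and the adjoint as involution), and M is an m-regular full left Hilbert K_A(M)-module with action f•m = f(m) and inner product ⟨y,x⟩ = Θ_{y,x}. -/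
universe u v w

set_option autoImplicit false

open CategoryTheory

/-- The sup-lattice of compact operators on `M`. -/
abbrev KOp (A : Type u) [InvQuantale A] (M : Type u) [CompleteLattice M]
    [QPreHilb A M] : Type u :=
  {f : M → M // IsCompactOp A f}

/-- A witness that `K_A(M)` is an m-regular involutive quantale (ordered pointwise,
multiplication = composition, star = the adjoint), and that `M` is an m-regular full
left Hilbert `K_A(M)`-module via `f • m = f m` and `⟨y, x⟩ = Θ_{y,x}`. -/
structure Stmt2Witness (A : Type u) [InvQuantale A] (M : Type u) [CompleteLattice M]
    [QHilb A M] : Type u where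
  [qK : InvQuantale (KOp A M)]
  le_iff : ∀ f g : KOp A M, f ≤ g ↔ ∀ x : M, f.1 x ≤ g.1 x
  mul_def : ∀ f g : KOp A M, (f * g).1 = f.1 ∘ g.1
  star_def : ∀ f : KOp A M, IsAdjointPair A f.1 (Star.star f).1
  kreg : InvQuantale.MReg (KOp A M)
  [lstr : QLHilb (KOp A M) M]
  lact_def : ∀ (f : KOp A M) (m : M), QLMod.lact f m = f.1 m
  lip_def : ∀ y x : M, (QLPreHilb.lip (A := KOp A M) y x).1 = theta A y x
  less : LEssential (KOp A M) M
  lsep : LSeparated (KOp A M) M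
  lfull : LFull (KOp A M) M

namespace KAux

variable {A : Type u} [InvQuantale A] {M : Type u} [CompleteLattice M]

theorem qact_mono_right [QMod A M] (m : M) {a b : A} (h : a ≤ b) : qact m a ≤ qact m b := by
  have h1 : qact m (sSup {a, b}) = ⨆ c ∈ ({a, b} : Set A), qact m c := QMod.act_sSup _ _
  rw [sSup_pair, sup_eq_right.2 h] at h1
  rw [h1]
  exact le_biSup (fun c => qact m c) (by simp)

/-- Adjointness of rank-one operators. -/
theorem theta_adj [QPreHilb A M] (n m : M) :
    IsAdjointPair A (theta A n m) (theta A m n) := by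
  intro x y
  have h1 : qip A y (qact n (qip A m x)) = qip A y n * qip A m x :=
    (QPreHilb.ip_mul _ _ _).symm
  have h2 : qip A x (qact m (qip A n y)) = qip A x m * qip A n y :=
    (QPreHilb.ip_mul _ _ _).symm
  show qip A (qact n (qip A m x)) y = qip A x (qact m (qip A n y))
  have h3 : ∀ u v : M, star (qip A u v) = qip A v u := QPreHilb.star_ip
  rw [h2, ← h3 y, h1, InvQuantale.qstar_mul, h3, h3]

theorem adj_unique [QHilb A M] {f g h : M → M} (h1 : IsAdjointPair A f g)
    (h2 : IsAdjointPair A f h) : g = h := by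
  funext n
  exact QHilb.ip_sep (A := A) _ _ fun p => (h1 p n).symm.trans (h2 p n)

theorem adj_iSup [QPreHilb A M] {ι : Sort w} {f g : ι → M → M}
    (h : ∀ i, IsAdjointPair A (f i) (g i)) :
    IsAdjointPair A (fun x => ⨆ i, f i x) (fun x => ⨆ i, g i x) := by
  intro m n
  rw [qip_iSup_left, qip_iSup_right]
  exact iSup_congr fun i => h i m n

theorem adj_comp [QPreHilb A M] {f g f' g' : M → M}
    (h : IsAdjointPair A f f') (h' : IsAdjointPair A g g') :
    IsAdjointPair A (f ∘ g) (g' ∘ f') :=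
  fun m n => (h (g m) n).trans (h' m (f' n))

theorem adj_sSup [QHilb A M] {f g : M → M} (h : IsAdjointPair A f g) (S : Set M) :
    f (sSup S) = ⨆ m ∈ S, f m := by
  apply QHilb.ip_sep (A := A)
  intro p
  have e : ∀ x, qip A p (f x) = qip A (g p) x := fun x => (h.symm' p x).symm
  have h3 : qip A (g p) (sSup S) = ⨆ m ∈ S, qip A (g p) m := QPreHilb.ip_sSup _ _
  show qip A p (f (sSup S)) = qip A p (⨆ m ∈ S, f m)
  simp only [qip_iSup_right, e, h3]

theorem adj_act [QHilb A M] {f g : M → M} (h : IsAdjointPair A f g) (m : M) (a : A) :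
    f (qact m a) = qact (f m) a := by
  apply QHilb.ip_sep (A := A)
  intro p
  have e : ∀ x, qip A p (f x) = qip A (g p) x := fun x => (h.symm' p x).symm
  have h3 : ∀ x y : M, qip A x (qact y a) = qip A x y * a :=
    fun x y => (QPreHilb.ip_mul _ _ _).symm
  show qip A p (f (qact m a)) = qip A p (qact (f m) a)
  rw [h3, e, e, h3]

theorem compact_theta [QPreHilb A M] (n m : M) : IsCompactOp A (theta A n m) :=
  ⟨{(n, m)}, fun x => by simp⟩

theorem compact_iSup [QPreHilb A M] {ι : Sort w} {f : ι → M → M}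
    (h : ∀ i, IsCompactOp A (f i)) : IsCompactOp A (fun x => ⨆ i, f i x) := by
  choose S hS using h
  refine ⟨⋃ i, S i, fun x => ?_⟩
  rw [iSup_iUnion]
  exact iSup_congr fun i => hS i x

theorem compact_adj [QPreHilb A M] {f : M → M} (h : IsCompactOp A f) :
    ∃ g, IsCompactOp A g ∧ IsAdjointPair A f g := by
  obtain ⟨S, hS⟩ := h
  refine ⟨fun x => ⨆ p : S, theta A p.1.2 p.1.1 x,
    compact_iSup fun p => compact_theta _ _, ?_⟩
  have : f = fun x => ⨆ p : S, theta A p.1.1 p.1.2 x := by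
    funext x; rw [hS, iSup_subtype]
  rw [this]
  exact adj_iSup fun p => theta_adj _ _

theorem theta_comp [QPreHilb A M] {g g' : M → M} (h : IsAdjointPair A g g') (n m : M) :
    theta A n m ∘ g = theta A n (g' m) := by
  funext x
  show qact n (qip A m (g x)) = qact n (qip A (g' m) x)
  rw [h.symm' m x]

theorem comp_theta [QHilb A M] {g g' : M → M} (h : IsAdjointPair A g g') (n m : M) :
    g ∘ theta A n m = theta A (g n) m := by
  funext x
  exact adj_act h _ _

theorem compact_comp [QPreHilb A M] {f g : M → M} (hf : IsCompactOp A f)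
    (hg : IsCompactOp A g) : IsCompactOp A (f ∘ g) := by
  obtain ⟨S, hS⟩ := hf
  obtain ⟨g', -, hg'⟩ := compact_adj hg
  have : f ∘ g = fun x => ⨆ p : S, theta A p.1.1 (g' p.1.2) x := by
    funext x
    show f (g x) = _
    rw [hS, iSup_subtype]
    refine iSup_congr fun p => iSup_congr fun _ => ?_
    exact congrFun (theta_comp hg' p.1 p.2) x
  rw [this]
  exact compact_iSup fun p => compact_theta _ _

instance kSupSet [QPreHilb A M] : SupSet (KOp A M) :=
  ⟨fun S => ⟨fun x => ⨆ f : S, f.1.1 x, compact_iSup fun f => f.1.2⟩⟩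

theorem k_isLUB [QPreHilb A M] (S : Set (KOp A M)) : IsLUB S (sSup S) := by
  constructor
  · intro f hf x
    exact le_iSup (fun f : S => f.1.1 x) ⟨f, hf⟩
  · intro g hg x
    exact iSup_le fun f => hg f.2 x

@[reducible] def kLat [QPreHilb A M] : CompleteLattice (KOp A M) :=
  completeLatticeOfSup (KOp A M) k_isLUB

theorem k_sSup [QPreHilb A M] (S : Set (KOp A M)) (x : M) :
    (kLat.sSup S).1 x = ⨆ f ∈ S, f.1 x := by
  rw [← iSup_subtype'']
  rfl

theorem k_iSup [QPreHilb A M] {ι : Sort w} (F : ι → KOp A M) (x : M) :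
    (@iSup _ _ kLat.toSupSet F).1 x = ⨆ i, (F i).1 x := by
  rw [iSup]
  exact (k_sSup _ x).trans iSup_range

/-- The adjoint of a compact operator. -/
noncomputable def kStar [QPreHilb A M] (f : KOp A M) : KOp A M :=
  ⟨Classical.choose (compact_adj f.2), (Classical.choose_spec (compact_adj f.2)).1⟩

theorem kStar_adj [QPreHilb A M] (f : KOp A M) : IsAdjointPair A f.1 (kStar f).1 :=
  (Classical.choose_spec (compact_adj f.2)).2

theorem kStar_eq [QHilb A M] {f g : KOp A M} (h : IsAdjointPair A f.1 g.1) : kStar f = g :=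
  Subtype.ext (adj_unique (kStar_adj f) h)

@[reducible] noncomputable def kQuantale [QHilb A M] : InvQuantale (KOp A M) :=
  { kLat with
    mul := fun f g => ⟨f.1 ∘ g.1, compact_comp f.2 g.2⟩
    star := kStar
    qmul_assoc := fun _ _ _ => rfl
    mul_sSup := by
      intro a S
      apply Subtype.ext
      funext x
      refine Eq.trans ?_ (k_iSup _ x).symm
      refine Eq.trans ?_ (iSup_congr fun f => (k_iSup _ x).symm)
      show a.1 ((kLat.sSup S).1 x) = ⨆ f ∈ S, a.1 (f.1 x)
      rw [k_sSup, ← sSup_image, adj_sSup (kStar_adj a), iSup_image]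
    sSup_mul := by
      intro S a
      apply Subtype.ext
      funext x
      refine Eq.trans ?_ (k_iSup _ x).symm
      refine Eq.trans ?_ (iSup_congr fun f => (k_iSup _ x).symm)
      exact k_sSup S (a.1 x)
    qstar_star := fun a => kStar_eq (kStar_adj a).symm'
    star_sSup := by
      intro S
      apply kStar_eq
      have h := adj_iSup fun f : KOp A M => adj_iSup fun _ : f ∈ S => kStar_adj f
      convert h using 1
      · funext x; exact k_sSup S x
      · funext x
        refine (k_iSup _ x).trans ?_
        exact (iSup_congr fun f => (k_iSup _ x))
    qstar_mul := by
      intro a b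
      apply kStar_eq
      have h := adj_comp (kStar_adj a) (kStar_adj b)
      exact h }

/-- Rank one operators as elements of `KOp`. -/
def kTheta [QPreHilb A M] (n m : M) : KOp A M := ⟨theta A n m, compact_theta n m⟩

theorem gen [QPreHilb A M] (hM : Essential A M) (hfull : FullMod A M) (m : M) :
    m = sSup {z : M | (∃ p x y : M, z = qact p (qip A x y)) ∧ z ≤ m} := by
  apply le_antisymm
  · conv_lhs => rw [hM m]
    refine sSup_le ?_
    rintro _ ⟨⟨p, a, rfl⟩, hle⟩
    have e : qact p a = ⨆ b ∈ {b : A | (∃ m n : M, b = qip A m n) ∧ b ≤ a}, qact p b := by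
      conv_lhs => rw [hfull a]
      exact QMod.act_sSup _ _
    rw [e]
    refine iSup₂_le ?_
    rintro _ ⟨⟨x, y, rfl⟩, hb⟩
    exact le_sSup ⟨⟨p, x, y, rfl⟩, (qact_mono_right p hb).trans hle⟩
  · exact sSup_le fun z hz => hz.2

@[reducible] noncomputable def kHilb [QHilb A M] (hM : MRegMod A M) (hfull : FullMod A M) :
    @QLHilb (KOp A M) kQuantale M _ :=
  letI := kQuantale (A := A) (M := M)
  { lact := fun f m => f.1 m
    lact_mul := fun _ _ _ => rfl
    sSup_lact := fun S m => k_sSup S m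
    lact_sSup := fun f S => adj_sSup (kStar_adj f) S
    lip := kTheta
    lip_lact := fun f m n => Subtype.ext (comp_theta (kStar_adj f) m n)
    sSup_lip := by
      intro S n
      apply Subtype.ext
      funext x
      refine Eq.trans ?_ (k_iSup _ x).symm
      refine Eq.trans ?_ (iSup_congr fun f => (k_iSup _ x).symm)
      exact QMod.sSup_act _ _
    lip_sSup := by
      intro m S
      apply Subtype.ext
      funext x
      refine Eq.trans ?_ (k_iSup _ x).symm
      refine Eq.trans ?_ (iSup_congr fun f => (k_iSup _ x).symm)
      show qact m (qip A (sSup S) x) = ⨆ n ∈ S, qact m (qip A n x)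
      rw [show qip A (sSup S) x = ⨆ n ∈ S, qip A n x from QPreHilb.sSup_ip _ _]
      simp only [qact_iSup_right]
    star_lip := fun m n => kStar_eq (theta_adj m n)
    lip_sep := by
      intro m n h
      apply hM.2
      intro a
      have e : ∀ m : M, qact m a =
          ⨆ b ∈ {b : A | (∃ m n : M, b = qip A m n) ∧ b ≤ a}, qact m b := by
        intro m
        conv_lhs => rw [hfull a]
        exact QMod.act_sSup _ _
      rw [e, e]
      refine biSup_congr ?_
      rintro _ ⟨⟨x, y, rfl⟩, -⟩
      exact congrFun (congrArg Subtype.val (h x)) y }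

theorem k_less [QHilb A M] (hM : MRegMod A M) (hfull : FullMod A M) (m : M) :
    m = sSup {z : M | (∃ (f : KOp A M) (p : M), z = f.1 p) ∧ z ≤ m} := by
  apply le_antisymm
  · conv_lhs => rw [gen hM.1 hfull m]
    refine sSup_le_sSup ?_
    rintro _ ⟨⟨p, x, y, rfl⟩, hle⟩
    exact ⟨⟨kTheta p x, y, rfl⟩, hle⟩
  · exact sSup_le fun z hz => hz.2

theorem k_lsep [QHilb A M] (hA : InvQuantale.MReg A) (hfull : FullMod A M) (m n : M)
    (h : ∀ f : KOp A M, f.1 m = f.1 n) : m = n := by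
  apply QHilb.ip_sep (A := A)
  intro q
  have key : ∀ p r : M, qip A r p * qip A q m = qip A r p * qip A q n := by
    intro p r
    have h1 : qact p (qip A q m) = qact p (qip A q n) := h (kTheta p q)
    have h2 : ∀ a : A, qip A r p * a = qip A r (qact p a) := QPreHilb.ip_mul _ _
    rw [h2, h2, h1]
  have key2 : ∀ a : A, a * qip A q m = a * qip A q n := by
    intro a
    rw [hfull a, InvQuantale.sSup_mul, InvQuantale.sSup_mul]
    refine biSup_congr ?_
    rintro _ ⟨⟨x, y, rfl⟩, -⟩
    exact key y x
  have h3 : star (qip A q m) = star (qip A q n) := by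
    apply hA.2
    intro a
    show star (qip A q m) * a = star (qip A q n) * a
    have := congrArg star (key2 (star a))
    rwa [InvQuantale.qstar_mul, InvQuantale.qstar_mul, InvQuantale.qstar_star] at this
  have h4 := congrArg star h3
  rwa [InvQuantale.qstar_star, InvQuantale.qstar_star] at h4

theorem k_theta_gen [QHilb A M] (f : KOp A M) (U : KOp A M)
    (h : ∀ n m : M, kTheta n m ≤ f → kTheta n m ≤ U) : f ≤ U := by
  obtain ⟨S, hS⟩ := f.2
  intro x
  rw [hS]
  refine iSup₂_le fun p hp => ?_
  refine h p.1 p.2 (fun y => ?_) x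
  rw [hS]
  exact le_iSup₂ (f := fun (p : M × M) (_ : p ∈ S) => theta A p.1 p.2 y) p hp

theorem k_mreg [QHilb A M] (hM : MRegMod A M) (hfull : FullMod A M) :
    @InvQuantale.MReg (KOp A M) kQuantale := by
  letI := kQuantale (A := A) (M := M)
  constructor
  · intro f
    apply le_antisymm
    · apply k_theta_gen
      intro n m hf x
      show qact n (qip A m x) ≤ _
      conv_lhs => rw [gen hM.1 hfull n]
      rw [show ∀ (T : Set M) (a : A), qact (sSup T) a = ⨆ m ∈ T, qact m a from QMod.sSup_act]
      refine iSup₂_le ?_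
      rintro _ ⟨⟨p, y, z, rfl⟩, hle⟩
      have hc : ∀ w : M, theta A p y (theta A z m w) = qact (qact p (qip A y z)) (qip A m w) := by
        intro w
        exact congrFun (comp_theta (theta_adj p y) z m) w
      rw [← hc x]
      have hmem : (kTheta p y : KOp A M) * kTheta z m ≤ f := by
        intro w
        refine le_trans ?_ (hf w)
        refine (hc w).le.trans ?_
        have h1 : qact (sSup {qact p (qip A y z), n}) (qip A m w) =
          ⨆ c ∈ ({qact p (qip A y z), n} : Set M), qact c (qip A m w) := QMod.sSup_act _ _
        rw [sSup_pair, sup_eq_right.2 hle] at h1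
        show _ ≤ qact n (qip A m w)
        rw [h1]
        exact le_biSup (fun c => qact c (qip A m w)) (by simp)
      exact (k_isLUB {g : KOp A M | (∃ p a : KOp A M, g = qact p a) ∧ g ≤ f}).1
        ⟨⟨kTheta p y, kTheta z m, rfl⟩, hmem⟩ x
    · exact sSup_le fun z hz => hz.2
  · intro f g h
    apply Subtype.ext
    funext m
    rw [k_less hM hfull m, adj_sSup (kStar_adj f), adj_sSup (kStar_adj g)]
    refine biSup_congr ?_
    rintro _ ⟨⟨k, p, rfl⟩, -⟩
    exact congrFun (congrArg Subtype.val (h k)) p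

theorem k_lfull [QHilb A M] (f : KOp A M) :
    f = kLat.sSup {b : KOp A M | (∃ m n : M, b = kTheta m n) ∧ b ≤ f} := by
  apply le_antisymm
  · apply k_theta_gen
    intro n m h
    exact (k_isLUB _).1 ⟨⟨n, m, rfl⟩, h⟩
  · exact (k_isLUB _).2 fun z hz => hz.2

end KAux

/-- If `A` is an m-regular involutive quantale and `M` a full
m-regular right Hilbert `A`-module, then `K_A(M)` is an m-regular involutive quantale
and `M` is an m-regular full left Hilbert `K_A(M)`-module. -/
theorem compacts_mregular_quantale (A : Type u) [InvQuantale A]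
    (M : Type u) [CompleteLattice M] [QHilb A M]
    (hA : InvQuantale.MReg A) (hM : MRegMod A M) (hfull : FullMod A M) :
    Nonempty (Stmt2Witness A M) := by
  letI := KAux.kQuantale (A := A) (M := M)
  letI := KAux.kHilb hM hfull
  exact ⟨{ le_iff := fun f g => Iff.rfl
           mul_def := fun f g => rfl
           star_def := fun f => KAux.kStar_adj f
           kreg := KAux.k_mreg hM hfull
           lact_def := fun f m => rfl
           lip_def := fun y x => rfl
           less := KAux.k_less hM hfull
           lsep := KAux.k_lsep hA hfull
           lfull := KAux.k_lfull }⟩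
end

section
/- Let A be an m-regular involutive quantale and let M be an m-regular right Hilbert A-module. For each J-tuple μ = (m_j)_{j∈J} in M^J, the operator Ω_μ : A^J → M given by Ω_μ((a_j)_j) = ⋁_j m_j⋄a_j is a compact operator in K_A(A^J, M), hence its adjoint Ω_μ* : M → A^J, x ↦ (⟨m_j,x⟩)_j, lies in K_A(M, A^J). Moreover K_A(A^J, M) is isomorphic to M^J as a sup-lattice. -/
universe u v w

set_option autoImplicit false

open CategoryTheory

section Helpers

variable {A : Type u} [InvQuantale A]

/-- The family supported at `j` with value `b`. -/
def deltaFam {J : Type w} (j : J) (b : A) : J → A := fun i => ⨆ (_ : i = j), b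

theorem qip_pi_eq {J : Type w} (v x : J → A) : qip A v x = ⨆ i, star (v i) * x i := rfl

theorem qip_deltaFam {J : Type w} (j : J) (b : A) (x : J → A) :
    qip A (deltaFam j b) x = star b * x j := by
  rw [qip_pi_eq]
  simp only [deltaFam, Quantale.star_iSup, Quantale.iSup_mul, iSup_iSup_eq_left]

theorem qact_qip_left {M : Type v} [CompleteLattice M] [QPreHilb A M] (p x : M) (a : A) :
    qip A (qact p a) x = star a * qip A p x := by
  have h1 : qip A (qact p a) x = star (qip A x (qact p a)) := (QPreHilb.star_ip _ _).symm
  have h2 : qip A x (qact p a) = qip A x p * a := (QPreHilb.ip_mul _ _ _).symm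
  have h3 : star (qip A x p) = qip A p x := QPreHilb.star_ip _ _
  rw [h1, h2, InvQuantale.qstar_mul, h3]

theorem essential_iSup {M : Type v} [CompleteLattice M] [QMod A M] (h : Essential A M) (m : M) :
    m = ⨆ t : {t : M × A // qact t.1 t.2 ≤ m}, qact t.1.1 t.1.2 := by
  apply le_antisymm
  · conv_lhs => rw [h m]
    refine sSup_le ?_
    rintro x ⟨⟨p, a, rfl⟩, hx⟩
    exact le_iSup (fun t : {t : M × A // qact t.1 t.2 ≤ m} => qact t.1.1 t.1.2) ⟨(p, a), hx⟩
  · exact iSup_le fun t => t.2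

theorem qact_sup_left {M : Type v} [CompleteLattice M] [QMod A M] (m n : M) (a : A) :
    qact (m ⊔ n) a = qact m a ⊔ qact n a := by
  rw [← sSup_pair, qact, QMod.sSup_act, iSup_pair]

theorem qact_mono_left {M : Type v} [CompleteLattice M] [QMod A M] {m n : M} (h : m ≤ n) (a : A) :
    qact m a ≤ qact n a := by
  rw [← sup_eq_right, ← qact_sup_left, sup_eq_right.2 h]

theorem omega_deltaFam {M : Type v} [CompleteLattice M] [QMod A M] {J : Type w} (μ : J → M)
    (j : J) (a : A) : (⨆ i, qact (μ i) (deltaFam j a i)) = qact (μ j) a := by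
  simp only [deltaFam, qact_iSup_right, iSup_iSup_eq_left]

theorem omega_isCompact {M : Type v} [CompleteLattice M] [QPreHilb A M] (h : Essential A M)
    {J : Type w} (μ : J → M) :
    IsCompactOp A (fun v : J → A => ⨆ j, qact (μ j) (v j)) := by
  refine ⟨Set.range fun s : (Σ j, {t : M × A // qact t.1 t.2 ≤ μ j}) =>
    (s.2.1.1, deltaFam s.1 (star s.2.1.2)), fun x => ?_⟩
  rw [iSup_range, iSup_sigma]
  refine iSup_congr fun j => ?_
  conv_lhs => rw [essential_iSup h (μ j)]
  rw [qact_iSup_left]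
  refine iSup_congr fun t => ?_
  simp only [theta]
  rw [qip_deltaFam, InvQuantale.qstar_star]
  exact (QMod.act_mul _ _ _).symm

theorem omega_star_isCompact {M : Type v} [CompleteLattice M] [QPreHilb A M] (h : Essential A M)
    {J : Type w} (μ : J → M) :
    IsCompactOp A (fun (x : M) (j : J) => qip A (μ j) x) := by
  refine ⟨Set.range fun s : (Σ j, {t : M × A // qact t.1 t.2 ≤ μ j}) =>
    (deltaFam s.1 (star s.2.1.2), s.2.1.1), fun x => ?_⟩
  rw [iSup_range, iSup_sigma]
  funext i
  have key : ∀ (j : J) (t : {t : M × A // qact t.1 t.2 ≤ μ j}),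
      theta A (deltaFam j (star t.1.2)) t.1.1 x i
        = ⨆ (_ : i = j), qip A (qact t.1.1 t.1.2) x := by
    intro j t
    show deltaFam j (star t.1.2) i * qip A t.1.1 x = _
    simp only [deltaFam, Quantale.iSup_mul, qact_qip_left]
  simp only [iSup_apply, key]
  have h2 : ∀ j, (⨆ (t : {t : M × A // qact t.1 t.2 ≤ μ j}),
      ⨆ (_ : i = j), qip A (qact t.1.1 t.1.2) x) = ⨆ (_ : i = j), qip A (μ j) x := by
    intro j
    rw [iSup_comm]
    refine iSup_congr fun _ => ?_
    conv_rhs => rw [essential_iSup h (μ j)]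
    rw [qip_iSup_left]
  simp only [h2, iSup_iSup_eq_right]

theorem compact_eq_omega {M : Type v} [CompleteLattice M] [QPreHilb A M]
    {J : Type w} (f : (J → A) → M) (hf : IsCompactOp A f) :
    ∃ μ : J → M, (fun v : J → A => ⨆ j, qact (μ j) (v j)) = f := by
  obtain ⟨S, hS⟩ := hf
  refine ⟨fun j => ⨆ p ∈ S, qact p.1 (star (p.2 j)), ?_⟩
  funext x
  rw [hS]
  simp only [theta, qip_pi_eq, qact_iSup_right, qact_iSup_left]
  rw [iSup_comm]
  refine iSup_congr fun p => ?_
  rw [iSup_comm]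
  refine iSup_congr fun _ => iSup_congr fun j => ?_
  exact (QMod.act_mul _ _ _).symm

end Helpers

/-- For an m-regular involutive quantale `A`, an m-regular right
Hilbert `A`-module `M` and a `J`-tuple `μ` in `M^J`, the operator
`Ω_μ : A^J → M, (a_j) ↦ ⨆ j, m_j ⋄ a_j` is compact, it is adjoint to
`Ω_μ⋆ : x ↦ (⟨m_j, x⟩)_j` which is compact as well, and `K_A(A^J, M) ≅ M^J` as
sup-lattices. -/
theorem omega_compact (A : Type u) [InvQuantale A] (hA : InvQuantale.MReg A)
    (M : Type u) [CompleteLattice M] [QHilb A M] (hM : MRegMod A M)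
    (J : Type u) (μ : J → M) :
    IsCompactOp A (fun v : J → A => ⨆ j, qact (μ j) (v j)) ∧
    IsAdjointPair A (fun v : J → A => ⨆ j, qact (μ j) (v j))
      (fun (x : M) (j : J) => qip A (μ j) x) ∧
    IsCompactOp A (fun (x : M) (j : J) => qip A (μ j) x) ∧
    Nonempty ((J → M) ≃o {f : (J → A) → M // IsCompactOp A f}) := by
  refine ⟨omega_isCompact hM.1 μ, ?_, omega_star_isCompact hM.1 μ, ?_⟩
  · intro v n
    show qip A (⨆ j, qact (μ j) (v j)) n = ⨆ j, star (v j) * qip A (μ j) n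
    rw [qip_iSup_left]
    exact iSup_congr fun j => qact_qip_left _ _ _
  · let Φ : (J → M) → {f : (J → A) → M // IsCompactOp A f} := fun ν =>
      ⟨fun v : J → A => ⨆ j, qact (ν j) (v j), omega_isCompact hM.1 ν⟩
    have hle : ∀ ν ρ : J → M, Φ ν ≤ Φ ρ ↔ ν ≤ ρ := by
      intro ν ρ
      constructor
      · intro h j
        have h1 : ∀ a : A, qact (ν j) a ≤ qact (ρ j) a := by
          intro a
          have h2 : (⨆ i, qact (ν i) (deltaFam j a i)) ≤ ⨆ i, qact (ρ i) (deltaFam j a i) :=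
            h (deltaFam j a)
          rwa [omega_deltaFam, omega_deltaFam] at h2
        have h3 : ν j ⊔ ρ j = ρ j := hM.2 _ _ fun a => by
          rw [qact_sup_left, sup_eq_right.2 (h1 a)]
        exact sup_eq_right.1 h3
      · intro h v
        exact iSup_mono fun j => qact_mono_left (h j) _
    have hsurj : Function.Surjective Φ := by
      rintro ⟨f, hf⟩
      obtain ⟨ν, hν⟩ := compact_eq_omega f hf
      exact ⟨ν, Subtype.ext hν⟩
    have hinj : Function.Injective Φ := fun ν ρ h =>
      le_antisymm ((hle _ _).1 h.le) ((hle _ _).1 h.ge)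
    exact ⟨{ Equiv.ofBijective Φ ⟨hinj, hsurj⟩ with map_rel_iff' := fun {a b} => hle a b }⟩
end

section
/- Let A be a unital involutive quantale and let M be an essential right Hilbert A-module. Then M is nuclear (the identity map id_M is a compact operator in K_A(M)) if and only if M is a retract of A^J in the category Hilb_A, i.e. there exist an index set J and adjointable maps i : M → A^J and r : A^J → M with r∘i = id_M. -/
universe u v w

set_option autoImplicit false

open CategoryTheory

theorem qaux_mul_bot {A : Type u} [InvQuantale A] (a : A) : a * ⊥ = ⊥ := by
  rw [← sSup_empty, InvQuantale.mul_sSup]; simp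

open Classical in
theorem qaux_delta {A : Type u} [InvQuantale A] {e : A}
    (he : ∀ a : A, e * a = a ∧ a * e = a) {J : Type u} (w : J → A) (j : J) :
    qip A w (fun k => if k = j then e else ⊥) = star (w j) := by
  show (⨆ k, star (w k) * (if k = j then e else ⊥)) = star (w j)
  apply le_antisymm
  · refine iSup_le fun k => ?_
    split_ifs with h
    · rw [h, (he _).2]
    · rw [qaux_mul_bot]; exact bot_le
  · refine le_trans ?_ (le_iSup _ j)
    rw [if_pos rfl, (he _).2]

theorem qaux_adj {A : Type u} [InvQuantale A] {M : Type u} [CompleteLattice M] [QHilb A M]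
    {J : Type u} (f : J → M) :
    IsAdjointPair A (fun (x : M) (j : J) => qip A (f j) x)
      (fun v : J → A => ⨆ j, qact (f j) (v j)) := by
  intro x v
  rw [qip_iSup_right]
  show (⨆ j, star (qip A (f j) x) * v j) = _
  refine iSup_congr fun j => ?_
  rw [show star (qip A (f j) x) = qip A x (f j) from QPreHilb.star_ip _ _]
  exact QPreHilb.ip_mul _ _ _

/-- Let `A` be a unital involutive quantale and `M` an essential
right Hilbert `A`-module.  Then `M` is nuclear (`id_M ∈ K_A(M)`) iff `M` is a retract
of some `A^J` in `Hilb_A`, i.e. there are adjointable maps `i : M → A^J`,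
`r : A^J → M` with `r ∘ i = id`. -/
theorem nuclear_iff_retract (A : Type u) [InvQuantale A]
    (hu : InvQuantale.IsUnital A)
    (M : Type u) [CompleteLattice M] [QHilb A M] (hM : Essential A M) :
    IsCompactOp A (id : M → M) ↔
      ∃ (J : Type u) (i : M → J → A) (r : (J → A) → M),
        Adjointable A i ∧ Adjointable A r ∧ r ∘ i = id := by
  classical
  constructor
  · rintro ⟨S, hS⟩
    refine ⟨S, fun x p => qip A p.1.2 x, fun v => ⨆ p : S, qact p.1.1 (v p),
      ⟨_, qaux_adj (fun p : S => p.1.2)⟩, ⟨_, (qaux_adj (fun p : S => p.1.1)).symm'⟩, ?_⟩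
    funext x
    rw [hS x, iSup_subtype']
    rfl
  · rintro ⟨J, i, r, ⟨i', hi⟩, ⟨r', hr⟩, hri⟩
    obtain ⟨e, he⟩ := hu
    let d : J → J → A := fun j k => if k = j then e else ⊥
    have hd : ∀ (w : J → A) (j : J), qip A w (d j) = star (w j) := qaux_delta he
    have key : ∀ v : J → A, r v = ⨆ j, qact (r (d j)) (v j) := by
      intro v
      apply QHilb.ip_sep (A := A)
      intro p
      have h1 := hr.symm' p v
      refine h1.symm.trans ?_
      refine Eq.trans ?_ (qip_iSup_right p _).symm
      show (⨆ j, star (r' p j) * v j) = _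
      refine iSup_congr fun j => ?_
      rw [← hd, hr.symm' p (d j)]
      exact QPreHilb.ip_mul _ _ _
    refine ⟨Set.range fun j => (r (d j), i' (d j)), fun x => ?_⟩
    rw [iSup_range, ← hri]
    show r (i x) = _
    rw [key]
    refine iSup_congr fun j => ?_
    show _ = qact (r (d j)) (qip A (i' (d j)) x)
    rw [hi.symm' (d j) x, ← InvQuantale.qstar_star (i x j), ← hd (i x) j]
    congr 1
    exact QPreHilb.star_ip _ _
end

section
/- Let A be an involutive quantale. Then the category of right pre-Hilbert A-modules (with module maps as morphisms) has limits of arbitrary diagrams; the limit of a diagram of pre-Hilbert A-modules is computed as the submodule of commuting tuples of the product. -/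
universe u v w

set_option autoImplicit false

open CategoryTheory

open CategoryTheory.Limits

/-- A bundled right pre-Hilbert `A`-module. -/
structure PreHilbMod (A : Type u) [InvQuantale A] : Type (u + 1) where
  carrier : Type u
  [lat : CompleteLattice carrier]
  [str : QPreHilb A carrier]

attribute [instance] PreHilbMod.lat PreHilbMod.str

theorem isModHom_id (A : Type u) [InvQuantale A] (M : Type v) [CompleteLattice M]
    [QMod A M] : IsModHom A (id : M → M) :=
  ⟨fun S => sSup_eq_iSup, fun _ _ => rfl⟩

theorem isModHom_comp {A : Type u} [InvQuantale A] {M N P : Type u}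
    [CompleteLattice M] [CompleteLattice N] [CompleteLattice P]
    [QMod A M] [QMod A N] [QMod A P] {f : M → N} {g : N → P}
    (hf : IsModHom A f) (hg : IsModHom A g) : IsModHom A (g ∘ f) := by
  refine ⟨fun S => ?_, fun m a => ?_⟩
  · show g (f (sSup S)) = ⨆ m ∈ S, g (f m)
    rw [hf.1, ← sSup_image, hg.1, iSup_image]
  · show g (f (qact m a)) = qact (g (f m)) a
    rw [hf.2, hg.2]

/-- The category of right pre-Hilbert `A`-modules with module maps as morphisms. -/
instance PreHilbMod.cat (A : Type u) [InvQuantale A] : Category.{u} (PreHilbMod A) where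
  Hom M N := {f : M.carrier → N.carrier // IsModHom A f}
  id M := ⟨id, isModHom_id A M.carrier⟩
  comp f g := ⟨g.1 ∘ f.1, isModHom_comp f.2 g.2⟩
  id_comp f := Subtype.ext rfl
  comp_id f := Subtype.ext rfl
  assoc f g h := Subtype.ext rfl

section LimitConstruction

variable {A : Type u} [InvQuantale A]

theorem isModHom_map_iSup {M N : Type u} [CompleteLattice M] [CompleteLattice N]
    [QMod A M] [QMod A N] {f : M → N} (hf : IsModHom A f) {ι : Sort w} (g : ι → M) :
    f (⨆ i, g i) = ⨆ i, f (g i) := by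
  rw [iSup]; exact (hf.1 _).trans iSup_range

variable {Jc : Type u} [SmallCategory Jc] (K : Jc ⥤ PreHilbMod A)

/-- Commuting tuples of a diagram. -/
abbrev CommTuple : Type u :=
  {x : ∀ j : Jc, (K.obj j).carrier //
    ∀ (j j' : Jc) (f : j ⟶ j'), (K.map f).1 (x j) = x j'}

/-- Pointwise joins of commuting tuples. -/
instance commTupleSupSet : SupSet (CommTuple K) where
  sSup S := ⟨fun j => ⨆ x ∈ S, x.1 j, fun j j' f => by
    rw [isModHom_map_iSup (K.map f).2]
    refine iSup_congr fun x => ?_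
    rw [isModHom_map_iSup (K.map f).2]
    exact iSup_congr fun _ => x.2 j j' f⟩

theorem commTuple_isLUB (S : Set (CommTuple K)) : IsLUB S (sSup S) := by
  constructor
  · intro x hx j
    exact le_iSup₂ (f := fun (y : CommTuple K) (_ : y ∈ S) => y.1 j) x hx
  · intro y hy j
    exact iSup₂_le fun x hx => hy hx j

instance commTupleLattice : CompleteLattice (CommTuple K) :=
  completeLatticeOfSup _ (commTuple_isLUB K)

theorem commTuple_sSup_apply (S : Set (CommTuple K)) (j : Jc) :
    (sSup S).1 j = ⨆ x ∈ S, x.1 j := rfl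

theorem commTuple_iSup_apply {ι : Sort w} (g : ι → CommTuple K) (j : Jc) :
    (⨆ i, g i).1 j = ⨆ i, (g i).1 j := by
  rw [iSup, commTuple_sSup_apply, iSup_range]

/-- The pointwise pre-Hilbert structure on commuting tuples. -/
instance commTupleQPreHilb : QPreHilb A (CommTuple K) where
  act x a := ⟨fun j => qact (x.1 j) a, fun j j' f => by
    rw [(K.map f).2.2, x.2 j j' f]⟩
  act_mul x a b := Subtype.ext (funext fun j => QMod.act_mul (x.1 j) a b)
  sSup_act S a := by
    refine Subtype.ext (funext fun j => ?_)
    simp only [commTuple_iSup_apply, commTuple_sSup_apply, qact_iSup_left]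
  act_sSup x S := by
    refine Subtype.ext (funext fun j => ?_)
    simp only [commTuple_iSup_apply]
    exact QMod.act_sSup _ _
  ip x y := ⨆ j, qip A (x.1 j) (y.1 j)
  ip_mul x y a := by
    rw [Quantale.iSup_mul]
    exact iSup_congr fun j => QPreHilb.ip_mul _ _ _
  sSup_ip S y := by
    simp only [commTuple_sSup_apply, qip_iSup_left]
    rw [iSup_comm]
    exact iSup_congr fun x => iSup_comm
  ip_sSup x S := by
    simp only [commTuple_sSup_apply, qip_iSup_right]
    rw [iSup_comm]
    exact iSup_congr fun x => iSup_comm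
  star_ip x y := by
    rw [Quantale.star_iSup]
    exact iSup_congr fun j => QPreHilb.star_ip _ _

/-- The cone of commuting tuples. -/
def commTupleCone : Cone K where
  pt := ⟨CommTuple K⟩
  π :=
    { app := fun j => ⟨fun x => x.1 j, fun _ => rfl, fun _ _ => rfl⟩
      naturality := fun j j' f => Subtype.ext (funext fun x => (x.2 j j' f).symm) }

/-- The tuple induced by a cone. -/
def commTupleLift (s : Cone K) (m : s.pt.carrier) : CommTuple K :=
  ⟨fun j => (s.π.app j).1 m, fun j j' f =>
    congrFun (congrArg Subtype.val (s.w f)) m⟩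

theorem commTupleLift_isModHom (s : Cone K) : IsModHom A (commTupleLift K s) := by
  constructor
  · intro S
    refine Subtype.ext (funext fun j => ?_)
    simp only [commTuple_iSup_apply]
    exact (s.π.app j).2.1 S
  · intro m a
    exact Subtype.ext (funext fun j => (s.π.app j).2.2 m a)

/-- The cone of commuting tuples is a limit cone. -/
def commTupleIsLimit : IsLimit (commTupleCone K) where
  lift s := ⟨commTupleLift K s, commTupleLift_isModHom K s⟩
  fac s j := rfl
  uniq s m h := by
    refine Subtype.ext (funext fun x => Subtype.ext (funext fun j => ?_))
    exact congrFun (congrArg Subtype.val (h j)) x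

end LimitConstruction

/-- For an involutive quantale `A`, the category of right pre-Hilbert
`A`-modules has limits of arbitrary (small) diagrams; the limit of a diagram is
computed as the submodule of commuting tuples of the product. -/
theorem preHilbMod_hasLimits (A : Type u) [InvQuantale A] :
    HasLimitsOfSize.{u, u} (PreHilbMod A) ∧
    ∀ (Jc : Type u) [SmallCategory Jc] (K : Jc ⥤ PreHilbMod A),
      ∃ c : Cone K, Nonempty (IsLimit c) ∧
        c.pt.carrier =
          {x : ∀ j : Jc, (K.obj j).carrier //
            ∀ (j j' : Jc) (f : j ⟶ j'), (K.map f).1 (x j) = x j'} := by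
  exact ⟨⟨fun _ _ => ⟨fun K => ⟨⟨⟨commTupleCone K, commTupleIsLimit K⟩⟩⟩⟩⟩,
    fun _ _ K => ⟨commTupleCone K, ⟨commTupleIsLimit K⟩, rfl⟩⟩
end

section
/- Let A be a right separating involutive quantale (i.e. a·(-) = b·(-) as maps implies a = b) and let M be a full right Hilbert A-module. Then M is faithful: if m⋄a = m⋄b for all m ∈ M, then a = b. -/
universe u v w

set_option autoImplicit false

open CategoryTheory

/-- Let `A` be a right separating involutive quantale and `M` a full
right Hilbert `A`-module.  Then `M` is faithful. -/
theorem full_hilbert_faithful (A : Type u) [InvQuantale A]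
    (hsep : ∀ a b : A, (∀ c : A, a * c = b * c) → a = b)
    (M : Type u) [CompleteLattice M] [QHilb A M] (hfull : FullMod A M) :
    ∀ a b : A, (∀ m : M, qact m a = qact m b) → a = b := by
  intro a b h
  have h1 : ∀ c : A, c * a = c * b := by
    intro c
    rw [hfull c, InvQuantale.sSup_mul, InvQuantale.sSup_mul]
    refine iSup_congr fun x => iSup_congr fun hx => ?_
    obtain ⟨⟨m, n, rfl⟩, -⟩ := hx
    have e1 := QPreHilb.ip_mul (A := A) m n a
    have e2 := QPreHilb.ip_mul (A := A) m n b
    have e3 : QMod.act n a = QMod.act n b := h n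
    exact e1.trans ((congrArg _ e3).trans e2.symm)
  have h2 : star a = star b := by
    apply hsep
    intro c
    have h3 := congrArg star (h1 (star c))
    rwa [InvQuantale.qstar_mul, InvQuantale.qstar_mul, InvQuantale.qstar_star] at h3
  have h4 := congrArg star h2
  rwa [InvQuantale.qstar_star, InvQuantale.qstar_star] at h4
end
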